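/- arXiv:1908.09350 — 3 statements merged into one kernel-verified Lean document; each statement's English description precedes it below -/
import Mathlib

section
/- Let Δ be a d-dimensional orientable pseudomanifold with pseudomanifold orientation γ. Then the Hilbert basis of ker⁺L_{d−1} equals the set of incidence vectors of the simple directed cycles of the γ-incidence graph Γ(Δ,γ). Equivalently, a nonzero τ ∈ ker⁺L_{d−1} cannot be written as a sum of two nonzero elements of ker⁺L_{d−1} if and only if τ is the incidence vector of a simple directed cycle of Γ(Δ,γ). -/
open Finset Matrix

/-- A finite abstract simplicial complex on the vertex set `Fin n`: a collection of
finite subsets of `Fin n` (its faces) closed under taking subsets. -/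
structure SComplex (n : ℕ) where
  faces : Finset (Finset (Fin n))
  down_closed : ∀ s ∈ faces, ∀ t ⊆ s, t ∈ faces

namespace SComplex

variable {n : ℕ} (Δ : SComplex n)

/-- The faces of cardinality `k`, i.e. the `(k-1)`-dimensional faces. -/
def Faces (k : ℕ) : Finset (Finset (Fin n)) :=
  Δ.faces.filter fun f => f.card = k

/-- The group of `(k-1)`-dimensional chains: formal `ℤ`-linear combinations of the
faces of cardinality `k`.  (So `Chain 0` plays the role of `C_{-1}(Δ) ≅ ℤ`, generated
by the empty face, and `Chain (i+1)` is the group `C_i(Δ)` of `i`-dimensional chains.) -/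
abbrev Chain (k : ℕ) : Type := {f // f ∈ Δ.Faces k} → ℤ

/-- The sign `(-1)^j` with which the subface `g` (obtained from `f` by deleting its
`j`-th smallest vertex) occurs in the boundary of `f`; `0` if `g` is not a
codimension-one subface of `f`. -/
def bcoef (f g : Finset (Fin n)) : ℤ :=
  if g ⊆ f ∧ f.card = g.card + 1 then
    ∑ v ∈ f \ g, (-1 : ℤ) ^ (f.filter (fun x => x < v)).card
  else 0

/-- The matrix (in the standard bases, with the standard orientation) of the boundary
map from chains on faces of cardinality `k+1` to chains on faces of cardinality `k`. -/
def B (k : ℕ) : Matrix {f // f ∈ Δ.Faces k} {f // f ∈ Δ.Faces (k + 1)} ℤ :=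
  fun g f => bcoef (f : Finset (Fin n)) (g : Finset (Fin n))

/-- The simplicial boundary map `∂_k : C_k(Δ) → C_{k-1}(Δ)` (standard orientation),
as a map `Chain (k+1) → Chain k`.  For `k = 0` this is the reduced boundary map into
`C_{-1}(Δ) ≅ ℤ`. -/
noncomputable def bdry (k : ℕ) : Δ.Chain (k + 1) →ₗ[ℤ] Δ.Chain k :=
  (Δ.B k).mulVecLin

/-- The transpose `∂_kᵗ` of the boundary map. -/
noncomputable def tbdry (k : ℕ) : Δ.Chain k →ₗ[ℤ] Δ.Chain (k + 1) :=
  ((Δ.B k)ᵀ).mulVecLin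

/-- The matrix of the `i`-th (up-down combinatorial) Laplacian. -/
def LapM (i : ℕ) : Matrix {f // f ∈ Δ.Faces (i + 1)} {f // f ∈ Δ.Faces (i + 1)} ℤ :=
  Δ.B (i + 1) * (Δ.B (i + 1))ᵀ

/-- The `i`-th Laplacian `L_i = ∂_{i+1} ∘ ∂_{i+1}ᵗ` on `i`-dimensional chains. -/
noncomputable def Lap (i : ℕ) : Δ.Chain (i + 1) →ₗ[ℤ] Δ.Chain (i + 1) :=
  (Δ.LapM i).mulVecLin

/-- A chain is effective if all of its coefficients are nonnegative. -/
def Effective {k : ℕ} (σ : Δ.Chain k) : Prop := ∀ f, 0 ≤ σ f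

/-- `σ·h = Σ_f σ(f)h(f)`. -/
def dot {k : ℕ} (σ h : Δ.Chain k) : ℤ := ∑ f, σ f * h f

/-- The `i`-th nonnegative kernel `ker⁺L_i`: effective `i`-chains in `ker L_i`. -/
def kerPlus (i : ℕ) : Set (Δ.Chain (i + 1)) :=
  {τ | Δ.Lap i τ = 0 ∧ Δ.Effective τ}

/-- Two `i`-chains are linearly equivalent if their difference lies in `im L_i`. -/
def LinEquiv (i : ℕ) (σ σ' : Δ.Chain (i + 1)) : Prop :=
  σ' - σ ∈ LinearMap.range (Δ.Lap i)

/-- An `i`-chain is winnable if it is linearly equivalent to an effective `i`-chain. -/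
def Winnable (i : ℕ) (σ : Δ.Chain (i + 1)) : Prop :=
  ∃ σ', Δ.Effective σ' ∧ Δ.LinEquiv i σ σ'

/-- The Hilbert basis of `ker⁺L_i`: its nonzero elements that are not the sum of two
nonzero elements of `ker⁺L_i`. -/
def hilbBasis (i : ℕ) : Set (Δ.Chain (i + 1)) :=
  {τ | τ ∈ Δ.kerPlus i ∧ τ ≠ 0 ∧
    ¬ ∃ a ∈ Δ.kerPlus i, ∃ b ∈ Δ.kerPlus i, a ≠ 0 ∧ b ≠ 0 ∧ τ = a + b}

/-- The cycles among the chains on faces of cardinality `k`: the kernel of the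
(reduced) boundary map `∂_{k-1}`.  For `k = 0` (the `(-1)`-chains, where the boundary
map is zero) every chain is a cycle. -/
noncomputable def cycles : (k : ℕ) → Submodule ℤ (Δ.Chain k)
  | 0 => ⊤
  | (k + 1) => LinearMap.ker (Δ.bdry k)

/-- The image of the `i`-th Laplacian, viewed inside the `i`-cycles. -/
noncomputable def critSub (i : ℕ) : Submodule ℤ ↥(Δ.cycles (i + 1)) :=
  Submodule.comap (Δ.cycles (i + 1)).subtype (LinearMap.range (Δ.Lap i))

/-- The `i`-th critical group `crit_i(Δ) = ker ∂_i / im L_i`. -/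
noncomputable abbrev Crit (i : ℕ) : Type :=
  ↥(Δ.cycles (i + 1)) ⧸ Δ.critSub i

/-- The image of the boundary map `∂_k`, viewed inside the cycles `cycles k`. -/
noncomputable def bdrySub (k : ℕ) : Submodule ℤ ↥(Δ.cycles k) :=
  Submodule.comap (Δ.cycles k).subtype (LinearMap.range (Δ.bdry k))

/-- The reduced homology group `H̃_{k-1}(Δ) = ker ∂_{k-1} / im ∂_k` (so the `i`-th
reduced homology group of `Δ` is `RedHomologyAt (i+1)`). -/
noncomputable abbrev RedHomologyAt (k : ℕ) : Type :=
  ↥(Δ.cycles k) ⧸ Δ.bdrySub k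

/-- The orthogonal complement `(ker L_i)^⊥` of `ker L_i` in the `i`-chains. -/
def kerPerp (i : ℕ) : Submodule ℤ (Δ.Chain (i + 1)) where
  carrier := {σ | ∀ τ ∈ LinearMap.ker (Δ.Lap i), Δ.dot σ τ = 0}
  add_mem' := by
    intro a b ha hb τ hτ
    have h : Δ.dot (a + b) τ = Δ.dot a τ + Δ.dot b τ := by
      simp [dot, Pi.add_apply, add_mul, Finset.sum_add_distrib]
    rw [h, ha τ hτ, hb τ hτ, add_zero]
  zero_mem' := by
    intro τ hτ
    simp [dot]
  smul_mem' := by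
    intro c a ha τ hτ
    have h : Δ.dot (c • a) τ = c * Δ.dot a τ := by
      simp [dot, Pi.smul_apply, Finset.mul_sum, mul_assoc]
    rw [h, ha τ hτ, mul_zero]

/-! ### Pseudomanifolds -/

/-- `Δ` is a pseudomanifold of dimension `d` (the facets are the faces of
cardinality `d+1`): it is pure, non-branching, and strongly connected. -/
def IsPseudomanifold (d : ℕ) : Prop :=
  (∀ f ∈ Δ.faces, ∃ g ∈ Δ.Faces (d + 1), f ⊆ g) ∧
  (∀ g ∈ Δ.Faces d, ((Δ.Faces (d + 1)).filter fun f => g ⊆ f).card ≤ 2) ∧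
  (∀ f ∈ Δ.Faces (d + 1), ∀ f' ∈ Δ.Faces (d + 1),
    Relation.ReflTransGen
      (fun a b => a ∈ Δ.Faces (d + 1) ∧ b ∈ Δ.Faces (d + 1) ∧ (a ∩ b).card = d) f f')

/-- The boundary `∂Δ` of a `d`-dimensional pseudomanifold: the `(d-1)`-faces contained
in exactly one facet. -/
def pmBoundary (d : ℕ) : Finset (Finset (Fin n)) :=
  (Δ.Faces d).filter fun g => ((Δ.Faces (d + 1)).filter fun f => g ⊆ f).card = 1

/-- A pseudomanifold orientation for a `d`-dimensional pseudomanifold: a top chain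
`γ` with all coefficients `±1` whose boundary is supported on `∂Δ`. -/
noncomputable def IsOrientation (d : ℕ) (γ : Δ.Chain (d + 1)) : Prop :=
  (∀ f, γ f = 1 ∨ γ f = -1) ∧
  (∀ g : {f // f ∈ Δ.Faces d},
    (g : Finset (Fin n)) ∉ Δ.pmBoundary d → Δ.bdry d γ g = 0)

/-- `γ_j` as a top-dimensional chain, for a vertex `j` of the `γ`-incidence graph:
the extra vertex `γ_0 = 0` is encoded by `none`, and the oriented facet `γ_f` by
`some f`. -/
noncomputable def gammaInd (D : ℕ) (γ : Δ.Chain (D + 1)) :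
    Option {f // f ∈ Δ.Faces (D + 1)} → Δ.Chain (D + 1)
  | none => 0
  | some f => Pi.single f (γ f)

/-- The edge of the `γ`-incidence graph corresponding to the `(D-1)`-dimensional face
`σ` goes from the vertex `a` to the vertex `b`: this means `∂ᵗ(σ) = γ_b - γ_a`. -/
noncomputable def edgeFromTo (D : ℕ) (γ : Δ.Chain (D + 1)) (σ : {f // f ∈ Δ.Faces D})
    (a b : Option {f // f ∈ Δ.Faces (D + 1)}) : Prop :=
  Δ.tbdry D (Pi.single σ 1) = Δ.gammaInd D γ b - Δ.gammaInd D γ a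

/-- `τ` is the incidence vector of a simple directed cycle of the `γ`-incidence graph
`Γ(Δ,γ)`: there is a closed directed walk with pairwise distinct vertices and pairwise
distinct edges whose edge labels sum to `τ`. -/
noncomputable def IsCycleVector (D : ℕ) (γ : Δ.Chain (D + 1)) (τ : Δ.Chain D) : Prop :=
  ∃ (k : ℕ) (hk : 0 < k) (v : Fin k → Option {f // f ∈ Δ.Faces (D + 1)})
    (e : Fin k → {f // f ∈ Δ.Faces D}),
    Function.Injective v ∧ Function.Injective e ∧
    (∀ t : Fin k, Δ.edgeFromTo D γ (e t) (v t) (v ⟨(t.1 + 1) % k, Nat.mod_lt _ hk⟩)) ∧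
    τ = ∑ t : Fin k, Pi.single (e t) (1 : ℤ)

/-! ### Spanning forests -/

/-- The chains supported on a set `F` of faces. -/
def suppIn (k : ℕ) (F : Finset (Finset (Fin n))) : Submodule ℤ (Δ.Chain k) where
  carrier := {σ | ∀ f : {f // f ∈ Δ.Faces k}, (f : Finset (Fin n)) ∉ F → σ f = 0}
  add_mem' := by
    intro a b ha hb f hf
    simp [Pi.add_apply, ha f hf, hb f hf]
  zero_mem' := by intro f hf; rfl
  smul_mem' := by
    intro c a ha f hf
    simp [Pi.smul_apply, ha f hf]

/-- The reduced homology group `H̃_{i-1}(Υ)` of the subcomplex `Υ` with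
`Skel_{i-1}(Υ) = Skel_{i-1}(Δ)` and with set of `i`-faces `F`: namely
`ker ∂_{i-1} / ∂_i(chains supported on F)`. -/
noncomputable abbrev forestHom (i : ℕ) (F : Finset (Finset (Fin n))) : Type :=
  ↥(Δ.cycles i) ⧸ Submodule.comap (Δ.cycles i).subtype
      (Submodule.map (Δ.bdry i) (Δ.suppIn (i + 1) F))

/-- `F ⊆ Δ_i` encodes a spanning `i`-forest of `Δ`: the `i`-dimensional subcomplex
`Υ` with `Skel_{i-1}(Υ) = Skel_{i-1}(Δ)` and with `i`-faces `F`, subject to: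
`H̃_i(Υ) = 0`; `β̃_{i-1}(Υ) = β̃_{i-1}(Δ)`; and `|Υ_i| = |Δ_i| - β̃_i(Skel_i(Δ))`
(note `H̃_i(Skel_i(Δ)) = ker ∂_i` since `Skel_i(Δ)` has no `(i+1)`-faces). -/
noncomputable def IsSpanningForest (i : ℕ) (F : Finset (Finset (Fin n))) : Prop :=
  F ⊆ Δ.Faces (i + 1) ∧
  (∀ σ ∈ Δ.suppIn (i + 1) F, Δ.bdry i σ = 0 → σ = 0) ∧
  Module.finrank ℤ (Δ.forestHom i F) = Module.finrank ℤ (Δ.RedHomologyAt i) ∧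
  F.card = (Δ.Faces (i + 1)).card - Module.finrank ℤ ↥(Δ.cycles (i + 1))

open scoped Classical in
/-- The `i`-forest number `τ_i(Δ) = Σ_Υ |T(H̃_{i-1}(Υ))|²`, the sum over all spanning
`i`-forests of `Δ`. -/
noncomputable def forestNumber (i : ℕ) : ℕ :=
  ∑ F ∈ (Δ.Faces (i + 1)).powerset.filter (fun F => Δ.IsSpanningForest i F),
    (Nat.card ↥(Submodule.torsion ℤ (Δ.forestHom i F))) ^ 2

/-- Restriction of chains to the coordinates indexed by a subset `Θ` of the faces
(i.e. setting the remaining coordinates to `0`). -/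
noncomputable def restrictTo (k : ℕ) (Θ : Finset (Finset (Fin n)))
    (hΘ : Θ ⊆ Δ.Faces k) : Δ.Chain k →ₗ[ℤ] ({f // f ∈ Θ} → ℤ) where
  toFun σ := fun a => σ ⟨a.1, hΘ a.2⟩
  map_add' := by intros; rfl
  map_smul' := by intros; rfl

/-- The reduced Laplacian: the square submatrix of `L_i` consisting of the rows
and columns indexed by `Θ`, as a linear map `ℤΘ → ℤΘ`. -/
noncomputable def redLap (i : ℕ) (Θ : Finset (Finset (Fin n)))
    (hΘ : Θ ⊆ Δ.Faces (i + 1)) : ({f // f ∈ Θ} → ℤ) →ₗ[ℤ] ({f // f ∈ Θ} → ℤ) :=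
  (Matrix.of fun a b : {f // f ∈ Θ} =>
    Δ.LapM i ⟨a.1, hΘ a.2⟩ ⟨b.1, hΘ b.2⟩).mulVecLin

end SComplex

/-! ### Nonnegative circulations on directed multigraphs -/

section Circulation

variable {V E : Type*} [Fintype E] [DecidableEq V]

/-- `a` is a circulation on the directed multigraph with edge set `E` and source and target
maps `src` and `tgt`: the inflow equals the outflow at every vertex. -/
def IsCirculation (src tgt : E → V) (a : E → ℤ) : Prop :=
  ∀ v, ∑ e with tgt e = v, a e = ∑ e with src e = v, a e

/-- An edge carrying positive flow is followed by an edge carrying positive flow. -/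
lemma IsCirculation.exists_next {src tgt : E → V} {a : E → ℤ}
    (ha : IsCirculation src tgt a) (h0 : ∀ e, 0 ≤ a e) {e : E} (he : 0 < a e) :
    ∃ e', src e' = tgt e ∧ 0 < a e' := by
  have hin : 0 < ∑ e' with tgt e' = tgt e, a e' :=
    Finset.sum_pos' (fun i _ => h0 i) ⟨e, by simp, he⟩
  rw [ha] at hin
  obtain ⟨e', he', hpos⟩ := Finset.exists_lt_of_sum_lt (f := fun _ => (0 : ℤ)) (by simpa using hin)
  exact ⟨e', by simpa using he', hpos⟩

/-- A nonzero nonnegative circulation has a simple directed cycle in its support. -/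
lemma IsCirculation.exists_cycle [Finite V] {src tgt : E → V} {a : E → ℤ}
    (ha : IsCirculation src tgt a) (h0 : ∀ e, 0 ≤ a e) (hne : a ≠ 0) :
    ∃ (k : ℕ) (hk : 0 < k) (v : Fin k → V) (e : Fin k → E), Function.Injective v ∧
      ∀ t, src (e t) = v t ∧ tgt (e t) = v ⟨(t.1 + 1) % k, Nat.mod_lt _ hk⟩ ∧ 0 < a (e t) := by
  obtain ⟨e₀, he₀⟩ : ∃ e, a e ≠ 0 := Function.ne_iff.mp hne
  let S := {v : V // ∃ e, src e = v ∧ 0 < a e}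
  choose out hsrc hpos using fun v : S => v.2
  let next : S → S := fun v => ⟨tgt (out v), ha.exists_next h0 (hpos v)⟩
  let x₀ : S := ⟨src e₀, e₀, rfl, lt_of_le_of_ne (h0 e₀) he₀.symm⟩
  obtain ⟨x, hx⟩ : ∃ x, x ∈ Function.periodicPts next := by
    obtain ⟨i, j, hij, heq⟩ := Finite.exists_ne_map_eq_of_infinite (fun i : ℕ => next^[i] x₀)
    wlog hlt : i < j generalizing i j
    · exact this j i hij.symm heq.symm (by omega)
    refine ⟨next^[i] x₀, j - i, by omega, ?_⟩
    rw [Function.IsPeriodicPt, Function.IsFixedPt, ← Function.iterate_add_apply,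
      Nat.sub_add_cancel hlt.le]
    exact heq.symm
  refine ⟨Function.minimalPeriod next x, Function.minimalPeriod_pos_of_mem_periodicPts hx,
    fun t => (next^[t.1] x).1, fun t => out (next^[t.1] x), ?_, fun t => ⟨hsrc _, ?_, hpos _⟩⟩
  · intro s t hst
    exact Fin.ext (Function.iterate_injOn_Iio_minimalPeriod s.2 t.2 (Subtype.ext hst))
  · simp only [Function.iterate_mod_minimalPeriod_eq, Function.iterate_succ_apply', next]

/-- A nonzero nonnegative circulation supported on a simple directed cycle is positive on the
whole cycle. -/
lemma IsCirculation.pos_of_supported_on_cycle {src tgt : E → V} {a : E → ℤ}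
    (ha : IsCirculation src tgt a) (h0 : ∀ e, 0 ≤ a e) (hne : a ≠ 0)
    {k : ℕ} (hk : 0 < k) {v : Fin k → V} {e : Fin k → E} (hv : Function.Injective v)
    (hsrc : ∀ t, src (e t) = v t)
    (htgt : ∀ t, tgt (e t) = v ⟨(t.1 + 1) % k, Nat.mod_lt _ hk⟩)
    (hsupp : ∀ e', 0 < a e' → ∃ t, e t = e') (t : Fin k) : 0 < a (e t) := by
  have step : ∀ t : Fin k, 0 < a (e t) → 0 < a (e ⟨(t.1 + 1) % k, Nat.mod_lt _ hk⟩) := by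
    intro t ht
    obtain ⟨e', he', hpos⟩ := ha.exists_next h0 ht
    obtain ⟨s, rfl⟩ := hsupp e' hpos
    rw [hsrc, htgt] at he'
    rwa [← hv he']
  obtain ⟨e₀, he₀⟩ : ∃ e, a e ≠ 0 := Function.ne_iff.mp hne
  obtain ⟨s, rfl⟩ := hsupp e₀ (lt_of_le_of_ne (h0 e₀) he₀.symm)
  have iter : ∀ m : ℕ, 0 < a (e ⟨(s.1 + m) % k, Nat.mod_lt _ hk⟩) := by
    intro m
    induction m with
    | zero =>
      simp only [add_zero, Nat.mod_eq_of_lt s.2]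
      exact lt_of_le_of_ne (h0 _) he₀.symm
    | succ m ih => simpa [← add_assoc] using step _ ih
  have hts : (s.1 + (k - s.1 + t.1)) % k = t.1 := by
    rw [show s.1 + (k - s.1 + t.1) = t.1 + k by omega, Nat.add_mod_right, Nat.mod_eq_of_lt t.2]
  simpa only [hts] using iter (k - s.1 + t.1)

end Circulation

/-- Shifting cyclically leaves a sum over `Fin k` unchanged. -/
lemma sum_fin_cyclic_shift {M : Type*} [AddCommMonoid M] {k : ℕ} (hk : 0 < k) (g : Fin k → M) :
    ∑ t : Fin k, g ⟨(t.1 + 1) % k, Nat.mod_lt _ hk⟩ = ∑ t, g t := by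
  obtain ⟨m, rfl⟩ : ∃ m, k = m + 1 := ⟨k - 1, by omega⟩
  rw [← Equiv.sum_comp (finRotate (m + 1)) g]
  refine Finset.sum_congr rfl fun t _ => congrArg g (Fin.ext ?_)
  simp [Fin.val_add]

namespace SComplex

variable {n : ℕ} {Δ : SComplex n}

/-- The Laplacian and the coboundary map have the same kernel. -/
lemma lap_eq_zero_iff (i : ℕ) (τ : Δ.Chain (i + 1)) :
    Δ.Lap i τ = 0 ↔ Δ.tbdry (i + 1) τ = 0 := by
  simp only [Lap, LapM, tbdry, mulVecLin_apply]
  exact Matrix.self_mul_conjTranspose_mulVec_eq_zero (Δ.B (i + 1)) τ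

lemma tbdry_single_apply (D : ℕ) (σ : {f // f ∈ Δ.Faces D}) (f : {f // f ∈ Δ.Faces (D + 1)}) :
    Δ.tbdry D (Pi.single σ 1) f = bcoef f.1 σ.1 := by
  simp [tbdry, B]

lemma bdry_apply (D : ℕ) (γ : Δ.Chain (D + 1)) (σ : {f // f ∈ Δ.Faces D}) :
    Δ.bdry D γ σ = ∑ f : {f // f ∈ Δ.Faces (D + 1)}, bcoef f.1 σ.1 * γ f := rfl

lemma tbdry_eq_sum (D : ℕ) (τ : Δ.Chain D) :
    Δ.tbdry D τ = ∑ σ, τ σ • Δ.tbdry D (Pi.single σ 1) := by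
  conv_lhs => rw [pi_eq_sum_univ' τ]
  simp only [map_sum, map_smul]

lemma card_of_mem_Faces {k : ℕ} {f : Finset (Fin n)} (hf : f ∈ Δ.Faces k) : f.card = k :=
  (Finset.mem_filter.mp hf).2

lemma bcoef_of_not_subset {f g : Finset (Fin n)} (h : ¬ g ⊆ f) : bcoef f g = 0 :=
  if_neg fun h' => h h'.1

lemma bcoef_of_subset {f g : Finset (Fin n)} (h : g ⊆ f) (hc : f.card = g.card + 1) :
    bcoef f g = 1 ∨ bcoef f g = -1 := by
  obtain ⟨v, hv⟩ : ∃ v, f \ g = {v} := by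
    rw [← Finset.card_eq_one, Finset.card_sdiff_of_subset h]
    omega
  rw [bcoef, if_pos ⟨h, hc⟩, hv, Finset.sum_singleton]
  exact neg_one_pow_eq_or ℤ _

lemma gammaInd_apply (D : ℕ) (γ : Δ.Chain (D + 1)) (a : Option {f // f ∈ Δ.Faces (D + 1)})
    (f : {f // f ∈ Δ.Faces (D + 1)}) :
    Δ.gammaInd D γ a f = γ f * if a = some f then 1 else 0 := by
  cases a with
  | none => simp [gammaInd]
  | some g =>
    by_cases h : g = f
    · subst h; simp [gammaInd]
    · simp [gammaInd, h, Ne.symm h]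

/-- An edge goes from `a` to `b` iff the signed incidence numbers of its face are the expected
ones. -/
lemma edgeFromTo_iff {D : ℕ} {γ : Δ.Chain (D + 1)} (hγ : ∀ f, γ f = 1 ∨ γ f = -1)
    {σ : {f // f ∈ Δ.Faces D}} {a b : Option {f // f ∈ Δ.Faces (D + 1)}} :
    Δ.edgeFromTo D γ σ a b ↔ ∀ f : {f // f ∈ Δ.Faces (D + 1)},
      bcoef f.1 σ.1 * γ f = (if b = some f then 1 else 0) - if a = some f then 1 else 0 := by
  rw [edgeFromTo, funext_iff]
  refine forall_congr' fun f => ?_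
  rw [tbdry_single_apply, Pi.sub_apply, gammaInd_apply, gammaInd_apply]
  rcases hγ f with h | h <;> rw [h] <;> constructor <;> intro h' <;> linarith

/-- In a pure complex every codimension-one face lies in a facet. -/
lemma IsPseudomanifold.exists_facet {D : ℕ} (hpm : Δ.IsPseudomanifold D)
    (σ : {f // f ∈ Δ.Faces D}) : ∃ f : {f // f ∈ Δ.Faces (D + 1)}, σ.1 ⊆ f.1 := by
  obtain ⟨f, hf, hσ⟩ := hpm.1 σ.1 (Finset.mem_filter.mp σ.2).1
  exact ⟨⟨f, hf⟩, hσ⟩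

/-- Every codimension-one face of an oriented pseudomanifold labels an edge of the incidence
graph. -/
lemma exists_edgeFromTo {D : ℕ} (hpm : Δ.IsPseudomanifold D) {γ : Δ.Chain (D + 1)}
    (hγ : Δ.IsOrientation D γ) (σ : {f // f ∈ Δ.Faces D}) :
    ∃ a b, Δ.edgeFromTo D γ σ a b := by
  simp only [edgeFromTo_iff hγ.1]
  have hnot : ∀ f : {f // f ∈ Δ.Faces (D + 1)}, ¬ σ.1 ⊆ f.1 → bcoef f.1 σ.1 * γ f = 0 :=
    fun f hf => by rw [bcoef_of_not_subset hf, zero_mul]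
  have hsub : ∀ f : {f // f ∈ Δ.Faces (D + 1)}, σ.1 ⊆ f.1 →
      bcoef f.1 σ.1 * γ f = 1 ∨ bcoef f.1 σ.1 * γ f = -1 := by
    intro f hf
    have hc : f.1.card = σ.1.card + 1 := by
      rw [card_of_mem_Faces f.2, card_of_mem_Faces σ.2]
    rcases bcoef_of_subset hf hc with h | h <;> rcases hγ.1 f with h' | h' <;> simp [h, h']
  have hcard := hpm.2.1 σ.1 σ.2
  set S := (Δ.Faces (D + 1)).filter fun f => σ.1 ⊆ f with hS
  have hmem : ∀ f : {f // f ∈ Δ.Faces (D + 1)}, σ.1 ⊆ f.1 ↔ f.1 ∈ S := fun f => by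
    simp [hS, f.2]
  obtain ⟨f₀, hf₀⟩ := hpm.exists_facet σ
  have hpos : 0 < S.card := Finset.card_pos.mpr ⟨f₀.1, (hmem f₀).1 hf₀⟩
  obtain h1 | h2 : S.card = 1 ∨ S.card = 2 := by omega
  · obtain ⟨g, hg⟩ := Finset.card_eq_one.mp h1
    have huniq : ∀ f : {f // f ∈ Δ.Faces (D + 1)}, f ≠ f₀ → ¬ σ.1 ⊆ f.1 := by
      intro f hf hσ
      rw [hmem, hg, Finset.mem_singleton] at hσ hf₀
      exact hf (Subtype.ext (hσ.trans hf₀.symm))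
    rcases hsub f₀ hf₀ with h | h
    · refine ⟨none, some f₀, fun f => ?_⟩
      by_cases hf : f = f₀
      · subst hf; simp [h]
      · simp [hnot f (huniq f hf), Ne.symm hf]
    · refine ⟨some f₀, none, fun f => ?_⟩
      by_cases hf : f = f₀
      · subst hf; simp [h]
      · simp [hnot f (huniq f hf), Ne.symm hf]
  · obtain ⟨g₁, g₂, hne, hg⟩ := Finset.card_eq_two.mp h2
    have hg₁ : g₁ ∈ S := by simp [hg]
    have hg₂ : g₂ ∈ S := by simp [hg]
    let f₁ : {f // f ∈ Δ.Faces (D + 1)} := ⟨g₁, (Finset.mem_filter.mp hg₁).1⟩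
    let f₂ : {f // f ∈ Δ.Faces (D + 1)} := ⟨g₂, (Finset.mem_filter.mp hg₂).1⟩
    have hf₁ : σ.1 ⊆ f₁.1 := (hmem f₁).2 hg₁
    have hf₂ : σ.1 ⊆ f₂.1 := (hmem f₂).2 hg₂
    have hne' : f₁ ≠ f₂ := fun h => hne (congrArg Subtype.val h)
    have huniq : ∀ f : {f // f ∈ Δ.Faces (D + 1)}, f ≠ f₁ → f ≠ f₂ → ¬ σ.1 ⊆ f.1 := by
      intro f h₁ h₂ hσ
      rw [hmem, hg, Finset.mem_insert, Finset.mem_singleton] at hσ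
      exact hσ.elim (fun h => h₁ (Subtype.ext h)) fun h => h₂ (Subtype.ext h)
    have hzero : bcoef f₁.1 σ.1 * γ f₁ + bcoef f₂.1 σ.1 * γ f₂ = 0 := by
      rw [← hγ.2 σ (by simp [pmBoundary, ← hS, h2]), bdry_apply]
      exact (Fintype.sum_eq_add f₁ f₂ hne' fun f hf => hnot f (huniq f hf.1 hf.2)).symm
    have key : ∀ a b : {f // f ∈ Δ.Faces (D + 1)}, a ≠ b →
        (∀ f : {f // f ∈ Δ.Faces (D + 1)}, f ≠ a → f ≠ b → ¬ σ.1 ⊆ f.1) →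
        bcoef a.1 σ.1 * γ a = -1 → bcoef b.1 σ.1 * γ b = 1 →
        ∀ f : {f // f ∈ Δ.Faces (D + 1)}, bcoef f.1 σ.1 * γ f =
          (if some b = some f then 1 else 0) - if some a = some f then 1 else 0 := by
      intro a b hab hu ha hb f
      by_cases h₁ : f = a
      · subst h₁; simp [ha, hab.symm]
      · by_cases h₂ : f = b
        · subst h₂; simp [hb, hab]
        · simp [hnot f (hu f h₁ h₂), Ne.symm h₁, Ne.symm h₂]
    rcases hsub f₁ hf₁ with h | h
    · exact ⟨_, _, key f₂ f₁ hne'.symm (fun f h₂ h₁ => huniq f h₁ h₂) (by linarith) h⟩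
    · exact ⟨_, _, key f₁ f₂ hne' huniq h (by linarith)⟩

/-- The endpoints of an edge of the incidence graph are determined by its face. -/
lemma edgeFromTo_unique {D : ℕ} (hpm : Δ.IsPseudomanifold D) {γ : Δ.Chain (D + 1)}
    (hγ : ∀ f, γ f = 1 ∨ γ f = -1) {σ : {f // f ∈ Δ.Faces D}}
    {a b a' b' : Option {f // f ∈ Δ.Faces (D + 1)}} (h : Δ.edgeFromTo D γ σ a b)
    (h' : Δ.edgeFromTo D γ σ a' b') : a = a' ∧ b = b' := by
  rw [edgeFromTo_iff hγ] at h h'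
  obtain ⟨f₀, hf₀⟩ := hpm.exists_facet σ
  have hne : bcoef f₀.1 σ.1 * γ f₀ ≠ 0 := by
    have hc : f₀.1.card = σ.1.card + 1 := by
      rw [card_of_mem_Faces f₀.2, card_of_mem_Faces σ.2]
    rcases bcoef_of_subset hf₀ hc with h | h <;> rcases hγ f₀ with h' | h' <;> simp [h, h']
  have hab : a ≠ b := fun hab => hne (by rw [h f₀, hab, sub_self])
  have hab' : a' ≠ b' := fun hab => hne (by rw [h' f₀, hab, sub_self])
  have key : ∀ f, (a = some f ↔ a' = some f) ∧ (b = some f ↔ b' = some f) := by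
    intro f
    have hf := (h f).symm.trans (h' f)
    have e₁ : ¬ (a = some f ∧ b = some f) := fun hh => hab (hh.1.trans hh.2.symm)
    have e₂ : ¬ (a' = some f ∧ b' = some f) := fun hh => hab' (hh.1.trans hh.2.symm)
    split_ifs at hf <;> simp_all
  exact ⟨Option.ext fun f => (key f).1, Option.ext fun f => (key f).2⟩

/-- Chains in the kernel of the coboundary map are circulations on the incidence graph. -/
lemma isCirculation_of_tbdry_eq_zero {D : ℕ} {γ : Δ.Chain (D + 1)}
    (hγ : ∀ f, γ f = 1 ∨ γ f = -1)
    {src tgt : {f // f ∈ Δ.Faces D} → Option {f // f ∈ Δ.Faces (D + 1)}}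
    (hedge : ∀ σ, Δ.edgeFromTo D γ σ (src σ) (tgt σ)) {τ : Δ.Chain D}
    (hτ : Δ.tbdry D τ = 0) : IsCirculation src tgt τ := by
  have hsome : ∀ f, ∑ σ with tgt σ = some f, τ σ = ∑ σ with src σ = some f, τ σ := by
    intro f
    have h := congrFun hτ f
    simp only [tbdry_eq_sum D τ, fun σ => show _ = _ from hedge σ, Finset.sum_apply, Pi.smul_apply,
      Pi.sub_apply, gammaInd_apply, Pi.zero_apply, smul_eq_mul] at h
    have hγf : γ f ≠ 0 := by rcases hγ f with h | h <;> simp [h]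
    rw [Finset.sum_filter, Finset.sum_filter, ← sub_eq_zero, ← Finset.sum_sub_distrib]
    refine (mul_eq_zero.mp ?_).resolve_left hγf
    rw [Finset.mul_sum]
    refine Eq.trans ?_ h
    refine Finset.sum_congr rfl fun σ _ => ?_
    split_ifs <;> ring
  have htot : ∑ v, ∑ σ with tgt σ = v, τ σ = ∑ v, ∑ σ with src σ = v, τ σ := by
    rw [Finset.sum_fiberwise, Finset.sum_fiberwise]
  rw [Fintype.sum_option, Fintype.sum_option, Finset.sum_congr rfl fun f _ => hsome f] at htot
  rintro (_ | f)
  · exact add_right_cancel htot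
  · exact hsome f

/-- The incidence vector of a closed directed walk lies in the kernel of the coboundary map. -/
lemma tbdry_cycle_eq_zero {D : ℕ} {γ : Δ.Chain (D + 1)} {k : ℕ} (hk : 0 < k)
    {v : Fin k → Option {f // f ∈ Δ.Faces (D + 1)}} {e : Fin k → {f // f ∈ Δ.Faces D}}
    (h : ∀ t : Fin k, Δ.edgeFromTo D γ (e t) (v t) (v ⟨(t.1 + 1) % k, Nat.mod_lt _ hk⟩)) :
    Δ.tbdry D (∑ t : Fin k, Pi.single (e t) (1 : ℤ)) = 0 := by
  rw [map_sum, Finset.sum_congr rfl fun t _ => show _ = _ from h t, Finset.sum_sub_distrib,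
    sum_fin_cyclic_shift hk fun t => Δ.gammaInd D γ (v t), sub_self]

/-- The sum of the indicators of distinct elements is the indicator of their range. -/
lemma sum_single_apply_self {ι E : Type*} [Fintype ι] [DecidableEq E] {e : ι → E}
    (he : Function.Injective e) (s : ι) : (∑ t, Pi.single (e t) (1 : ℤ) : E → ℤ) (e s) = 1 := by
  classical
  simp [Finset.sum_apply, Pi.single_apply, he.eq_iff]

lemma sum_single_apply_of_notMem {ι E : Type*} [Fintype ι] [DecidableEq E] {e : ι → E} {x : E}
    (hx : ¬ ∃ t, e t = x) : (∑ t, Pi.single (e t) (1 : ℤ) : E → ℤ) x = 0 := by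
  rw [Finset.sum_apply]
  exact Finset.sum_eq_zero fun t _ => Pi.single_eq_of_ne (fun h => hx ⟨t, h.symm⟩) _

end SComplex

/-- Let `Δ` be an orientable pseudomanifold of dimension `d+1` with
pseudomanifold orientation `γ`.  A nonzero `τ ∈ ker⁺L_{(d+1)-1}` cannot be written as
a sum of two nonzero elements of `ker⁺L_{(d+1)-1}` (i.e. `τ` belongs to the Hilbert
basis) if and only if `τ` is the incidence vector of a simple directed cycle of the
`γ`-incidence graph `Γ(Δ,γ)`. -/
theorem pseudomanifold_hilbert_basis {n : ℕ} (Δ : SComplex n) (d : ℕ)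
    (hpm : Δ.IsPseudomanifold (d + 1))
    (γ : Δ.Chain (d + 2)) (hγ : Δ.IsOrientation (d + 1) γ) :
    ∀ τ : Δ.Chain (d + 1),
      (τ ∈ Δ.kerPlus d ∧ τ ≠ 0 ∧
        ¬ ∃ a ∈ Δ.kerPlus d, ∃ b ∈ Δ.kerPlus d, a ≠ 0 ∧ b ≠ 0 ∧ τ = a + b) ↔
      Δ.IsCycleVector (d + 1) γ τ := by
  choose src tgt hedge using SComplex.exists_edgeFromTo hpm hγ
  have hcirc : ∀ a ∈ Δ.kerPlus d, IsCirculation src tgt a := fun a ha =>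
    SComplex.isCirculation_of_tbdry_eq_zero hγ.1 hedge ((SComplex.lap_eq_zero_iff d a).1 ha.1)
  intro τ
  constructor
  · rintro ⟨hτ, hne, hind⟩
    obtain ⟨k, hk, v, e, hv, h⟩ := (hcirc τ hτ).exists_cycle hτ.2 hne
    have he : Function.Injective e := fun s t hst =>
      hv (by rw [← (h s).1, ← (h t).1, hst])
    have hwalk : ∀ t : Fin k,
        Δ.edgeFromTo (d + 1) γ (e t) (v t) (v ⟨(t.1 + 1) % k, Nat.mod_lt _ hk⟩) := fun t => by
      rw [← (h t).1, ← (h t).2.1]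
      exact hedge (e t)
    refine ⟨k, hk, v, e, hv, he, hwalk, ?_⟩
    set c : Δ.Chain (d + 1) := ∑ t : Fin k, Pi.single (e t) (1 : ℤ) with hc
    have hlap : Δ.Lap d c = 0 :=
      (SComplex.lap_eq_zero_iff d c).2 (SComplex.tbdry_cycle_eq_zero hk hwalk)
    have hce : ∀ t, c (e t) = 1 := SComplex.sum_single_apply_self he
    have hbound : ∀ σ, 0 ≤ c σ ∧ c σ ≤ τ σ := by
      intro σ
      by_cases hσ : ∃ t, e t = σ
      · obtain ⟨t, rfl⟩ := hσ
        rw [hce]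
        exact ⟨zero_le_one, (h t).2.2⟩
      · rw [hc, SComplex.sum_single_apply_of_notMem hσ]
        exact ⟨le_rfl, hτ.2 σ⟩
    by_contra hτc
    refine hind ⟨c, ⟨hlap, fun σ => (hbound σ).1⟩, τ - c,
      ⟨by rw [map_sub, hτ.1, hlap, sub_zero], fun σ => sub_nonneg.2 (hbound σ).2⟩,
      fun h0 => ?_, sub_ne_zero.2 hτc, (add_sub_cancel c τ).symm⟩
    simpa [h0] using hce ⟨0, hk⟩
  · rintro ⟨k, hk, v, e, hv, he, hwalk, hτ⟩
    have hτe : ∀ t, τ (e t) = 1 := fun t => hτ ▸ SComplex.sum_single_apply_self he t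
    have hτ0 : ∀ σ, (¬ ∃ t, e t = σ) → τ σ = 0 := fun σ hσ =>
      hτ ▸ SComplex.sum_single_apply_of_notMem hσ
    refine ⟨⟨?_, fun σ => ?_⟩, fun h0 => ?_, ?_⟩
    · rw [hτ]
      exact (SComplex.lap_eq_zero_iff d _).2 (SComplex.tbdry_cycle_eq_zero hk hwalk)
    · by_cases hσ : ∃ t, e t = σ
      · obtain ⟨t, rfl⟩ := hσ
        rw [hτe]
        exact zero_le_one
      · rw [hτ0 σ hσ]
    · simpa [h0] using hτe ⟨0, hk⟩
    · rintro ⟨a, ha, b, hb, ha0, hb0, hab⟩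
      have hends := fun t => SComplex.edgeFromTo_unique hpm hγ.1 (hedge (e t)) (hwalk t)
      have hsupp : ∀ σ, 0 < a σ + b σ → ∃ t, e t = σ := by
        intro σ hσ
        by_contra hne
        have := hτ0 σ hne
        rw [hab, Pi.add_apply] at this
        omega
      have hapos := (hcirc a ha).pos_of_supported_on_cycle ha.2 ha0 hk hv (fun t => (hends t).1)
        (fun t => (hends t).2) (fun σ hσ => hsupp σ (add_pos_of_pos_of_nonneg hσ (hb.2 σ)))
        ⟨0, hk⟩
      have hbpos := (hcirc b hb).pos_of_supported_on_cycle hb.2 hb0 hk hv (fun t => (hends t).1)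
        (fun t => (hends t).2) (fun σ hσ => hsupp σ (add_pos_of_nonneg_of_pos (ha.2 σ) hσ))
        ⟨0, hk⟩
      have hone := hτe ⟨0, hk⟩
      rw [hab, Pi.add_apply] at hone
      omega
end

section
/- Let Δ be a d-dimensional orientable pseudomanifold. Suppose ω is a (d−1)-chain such that every (d−1)-chain σ with σ·h = ω·h for all h ∈ ker⁺L_{d−1} is winnable. Then every (d−1)-chain σ with σ·h ≥ ω·h for all h ∈ ker⁺L_{d−1} is winnable. -/
open Finset Matrix

/-- Integral potentials for difference constraints, by elimination of variables: if the
weighted arcs `R` are contained in an additively transitive relation `W` whose closed arcs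
have nonnegative weight, and the weights are bounded below, then `R` has a potential
on every finite set of vertices. -/
theorem exists_potential_of_closed_nonneg {V : Type*} [DecidableEq V] (W : V → V → ℤ → Prop)
    (htrans : ∀ a b c x y, W a b x → W b c y → W a c (x + y))
    (hclosed : ∀ a x, W a a x → 0 ≤ x) (S : Finset V) :
    ∀ R : V → V → ℤ → Prop, (∀ a b x, R a b x → W a b x) →
      (∃ m : ℤ, ∀ a b x, R a b x → m ≤ x) →
      ∃ p : V → ℤ, ∀ a ∈ S, ∀ b ∈ S, ∀ x, R a b x → p b ≤ p a + x := by
  induction S using Finset.induction_on with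
  | empty => exact fun _ _ _ => ⟨0, by simp⟩
  | insert v S hv ih =>
    intro R hR ⟨m, hm⟩
    obtain ⟨p, hp⟩ := ih (fun a b x => R a b x ∨ ∃ y z, R a v y ∧ R v b z ∧ x = y + z)
      (by
        rintro a b x (h | ⟨y, z, hy, hz, rfl⟩)
        · exact hR _ _ _ h
        · exact htrans _ _ _ _ _ (hR _ _ _ hy) (hR _ _ _ hz))
      (by
        refine ⟨min m (m + m), ?_⟩
        rintro a b x (h | ⟨y, z, hy, hz, rfl⟩)
        · exact (min_le_left _ _).trans (hm _ _ _ h)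
        · exact (min_le_right _ _).trans (add_le_add (hm _ _ _ hy) (hm _ _ _ hz)))
    have hmix : ∀ a ∈ S, ∀ b ∈ S, ∀ y z, R a v y → R v b z → p b - z ≤ p a + y := by
      intro a ha b hb y z hy hz
      have := hp a ha b hb (y + z) (Or.inr ⟨y, z, hy, hz, rfl⟩)
      linarith
    obtain ⟨q, hupper, hlower⟩ : ∃ q : ℤ, (∀ a ∈ S, ∀ y, R a v y → q ≤ p a + y) ∧
        ∀ b ∈ S, ∀ z, R v b z → p b ≤ q + z := by
      by_cases hne : ∃ b ∈ S, ∃ z, R v b z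
      · obtain ⟨b₀, hb₀, z₀, hz₀⟩ := hne
        obtain ⟨M, hM⟩ := (S.image p).bddAbove
        obtain ⟨q, ⟨b, hb, z, hz, rfl⟩, hq⟩ :=
          Int.exists_greatest_of_bdd (P := fun q => ∃ b ∈ S, ∃ z, R v b z ∧ q = p b - z)
            ⟨M - m, by
              rintro _ ⟨b, hb, z, hz, rfl⟩
              have : p b ≤ M := hM (Finset.mem_image_of_mem p hb)
              have := hm _ _ _ hz
              linarith⟩ ⟨_, b₀, hb₀, z₀, hz₀, rfl⟩
        refine ⟨_, fun a ha y hy => hmix a ha b hb y z hy hz, fun b' hb' z' hz' => ?_⟩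
        have := hq _ ⟨b', hb', z', hz', rfl⟩
        linarith
      · obtain ⟨M, hM⟩ := (S.image p).bddBelow
        refine ⟨M + m, fun a ha y hy => add_le_add (hM (by simpa using ⟨a, ha, rfl⟩))
          (hm _ _ _ hy), fun b hb z hz => absurd ⟨b, hb, z, hz⟩ hne⟩
    have hne : ∀ a ∈ S, a ≠ v := fun a ha h => hv (h ▸ ha)
    refine ⟨Function.update p v q, fun a ha b hb x hx => ?_⟩
    rcases Finset.mem_insert.1 ha with rfl | haS <;>
      rcases Finset.mem_insert.1 hb with rfl | hbS
    · have := hclosed _ _ (hR _ _ _ hx)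
      linarith
    · simpa [hne b hbS] using hlower b hbS x hx
    · simpa [hne a haS] using hupper a haS x hx
    · simpa [hne a haS, hne b hbS] using hp a haS b hbS x (Or.inl hx)

namespace SComplex

variable {n : ℕ} (Δ : SComplex n)

theorem bcoef_eq_one_or_neg_one {f g : Finset (Fin n)} (hgf : g ⊆ f)
    (hcard : f.card = g.card + 1) : bcoef f g = 1 ∨ bcoef f g = -1 := by
  obtain ⟨v, hv⟩ : ∃ v, f \ g = {v} := by
    rw [← Finset.card_eq_one, Finset.card_sdiff_of_subset hgf]
    omega
  rw [bcoef, if_pos ⟨hgf, hcard⟩, hv, Finset.sum_singleton]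
  exact neg_one_pow_eq_or ℤ _

theorem B_eq_one_or_neg_one {k : ℕ} (g : {f // f ∈ Δ.Faces k}) (f : {f // f ∈ Δ.Faces (k + 1)})
    (hgf : g.1 ⊆ f.1) : Δ.B k g f = 1 ∨ Δ.B k g f = -1 :=
  bcoef_eq_one_or_neg_one hgf <| by
    rw [(Finset.mem_filter.1 f.2).2, (Finset.mem_filter.1 g.2).2]

theorem B_eq_zero {k : ℕ} (g : {f // f ∈ Δ.Faces k}) (f : {f // f ∈ Δ.Faces (k + 1)})
    (hgf : ¬ g.1 ⊆ f.1) : Δ.B k g f = 0 :=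
  if_neg fun h => hgf h.1

theorem tbdry_single_apply_s13 {k : ℕ} (g : {f // f ∈ Δ.Faces k}) (f : {f // f ∈ Δ.Faces (k + 1)}) :
    Δ.tbdry k (Pi.single g 1) f = Δ.B k g f := by
  simp [tbdry]

theorem bdry_apply_s13 {k : ℕ} (y : Δ.Chain (k + 1)) (g : {f // f ∈ Δ.Faces k}) :
    Δ.bdry k y g = ∑ f, Δ.B k g f * y f := rfl

theorem dot_bdry {k : ℕ} (y : Δ.Chain (k + 1)) (h : Δ.Chain k) :
    Δ.dot (Δ.bdry k y) h = Δ.dot y (Δ.tbdry k h) := by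
  change Δ.B k *ᵥ y ⬝ᵥ h = y ⬝ᵥ (Δ.B k)ᵀ *ᵥ h
  rw [Matrix.mulVec_transpose, dotProduct_comm, Matrix.dotProduct_mulVec, dotProduct_comm]

theorem Lap_eq_bdry_tbdry (i : ℕ) (h : Δ.Chain (i + 1)) :
    Δ.Lap i h = Δ.bdry (i + 1) (Δ.tbdry (i + 1) h) := by
  simp [Lap, LapM, bdry, tbdry]

theorem Lap_eq_zero_iff (i : ℕ) (h : Δ.Chain (i + 1)) :
    Δ.Lap i h = 0 ↔ Δ.tbdry (i + 1) h = 0 := by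
  rw [Lap_eq_bdry_tbdry]
  refine ⟨fun H => ?_, fun H => by rw [H, map_zero]⟩
  have := Δ.dot_bdry (Δ.tbdry (i + 1) h) h
  rw [H] at this
  exact dotProduct_self_eq_zero.1 (this.symm.trans (zero_dotProduct h))

/-- In an oriented non-branching complex every ridge is an edge of the incidence graph. -/
theorem exists_edgeFromTo_s13 {k : ℕ} {γ : Δ.Chain (k + 1)} (hγ : Δ.IsOrientation k γ)
    (g : {f // f ∈ Δ.Faces k})
    (hg : ((Δ.Faces (k + 1)).filter fun f => g.1 ⊆ f).card ≤ 2) :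
    ∃ a b, Δ.edgeFromTo k γ g a b := by
  set T : Finset {f // f ∈ Δ.Faces (k + 1)} := Finset.univ.filter fun f => g.1 ⊆ f.1 with hT
  have hTcard : ((Δ.Faces (k + 1)).filter fun f => g.1 ⊆ f).card = T.card := by
    rw [← Finset.card_map (Function.Embedding.subtype _) (s := T)]
    congr 1
    ext f
    simp [hT, and_comm]
  have hzero : ∀ f ∉ T, Δ.B k g f = 0 := fun f hf => Δ.B_eq_zero g f (by simpa [hT] using hf)
  have hone : ∀ f ∈ T, Δ.B k g f = γ f ∨ Δ.B k g f = -γ f := by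
    intro f hf
    rcases Δ.B_eq_one_or_neg_one g f (by simpa [hT] using hf) with h | h <;>
      rcases hγ.1 f with h' | h' <;> simp [h, h']
  rw [hTcard] at hg
  interval_cases hc : T.card
  · rw [Finset.card_eq_zero] at hc
    refine ⟨none, none, funext fun f => ?_⟩
    rw [tbdry_single_apply_s13, hzero f (by simp [hc])]
    simp
  · obtain ⟨f₁, hf₁⟩ := Finset.card_eq_one.1 hc
    rcases hone f₁ (by simp [hf₁]) with h₁ | h₁
    · refine ⟨none, some f₁, funext fun f => ?_⟩
      rw [tbdry_single_apply_s13]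
      by_cases hf : f = f₁
      · subst hf; simp [gammaInd, h₁]
      · simp [gammaInd, hzero f (by simpa [hf₁] using hf), hf]
    · refine ⟨some f₁, none, funext fun f => ?_⟩
      rw [tbdry_single_apply_s13]
      by_cases hf : f = f₁
      · subst hf; simp [gammaInd, h₁]
      · simp [gammaInd, hzero f (by simpa [hf₁] using hf), hf]
  · obtain ⟨f₁, f₂, hne, hf₁₂⟩ := Finset.card_eq_two.1 hc
    have hsum : Δ.B k g f₁ * γ f₁ + Δ.B k g f₂ * γ f₂ = 0 := by
      have h := hγ.2 g (by simp [pmBoundary, hTcard])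
      rw [bdry_apply_s13, ← Finset.sum_subset (Finset.subset_univ T)
        (fun f _ hf => by rw [hzero f hf, zero_mul]), hf₁₂, Finset.sum_pair hne] at h
      exact h
    have hsq : ∀ f, γ f * γ f = 1 := fun f => by rcases hγ.1 f with h | h <;> simp [h]
    have edge : ∀ e₁ e₂, e₁ ≠ e₂ → T = {e₁, e₂} → Δ.B k g e₁ = -γ e₁ → Δ.B k g e₂ = γ e₂ →
        Δ.edgeFromTo k γ g (some e₁) (some e₂) := by
      intro e₁ e₂ hne hTe h₁ h₂
      refine funext fun f => ?_
      rw [tbdry_single_apply_s13]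
      by_cases hf : f = e₁
      · subst hf; simp [gammaInd, h₁, hne]
      · by_cases hf' : f = e₂
        · subst hf'; simp [gammaInd, h₂, hf]
        · simp [gammaInd, hzero f (by simp [hTe, hf, hf']), hf, hf']
    rcases hone f₁ (by simp [hf₁₂]) with h₁ | h₁ <;> rcases hone f₂ (by simp [hf₁₂]) with h₂ | h₂
    · have := hsq f₁; have := hsq f₂; simp only [h₁, h₂] at hsum; linarith
    · exact ⟨_, _, edge f₂ f₁ hne.symm (by rw [hf₁₂, Finset.pair_comm]) h₂ h₁⟩
    · exact ⟨_, _, edge f₁ f₂ hne hf₁₂ h₁ h₂⟩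
    · have := hsq f₁; have := hsq f₂; simp only [h₁, h₂, neg_mul] at hsum; linarith

theorem dot_add_left {k : ℕ} (a b h : Δ.Chain k) : Δ.dot (a + b) h = Δ.dot a h + Δ.dot b h :=
  add_dotProduct a b h

theorem dot_add_right {k : ℕ} (a h h' : Δ.Chain k) :
    Δ.dot a (h + h') = Δ.dot a h + Δ.dot a h' :=
  dotProduct_add a h h'

/-- Integral Farkas lemma for the boundary map of an oriented non-branching complex. -/
theorem exists_bdry_le {k : ℕ} {γ : Δ.Chain (k + 1)} (hγ : Δ.IsOrientation k γ)
    (hbranch : ∀ g ∈ Δ.Faces k, ((Δ.Faces (k + 1)).filter fun f => g ⊆ f).card ≤ 2)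
    (c : Δ.Chain k)
    (hc : ∀ h : Δ.Chain k, Δ.Effective h → Δ.tbdry k h = 0 → 0 ≤ Δ.dot c h) :
    ∃ y : Δ.Chain (k + 1), ∀ g, Δ.bdry k y g ≤ c g := by
  classical
  obtain ⟨p, hp⟩ := exists_potential_of_closed_nonneg
    (V := Option {f // f ∈ Δ.Faces (k + 1)})
    (fun a b x => ∃ h : Δ.Chain k, Δ.Effective h ∧
      Δ.tbdry k h = Δ.gammaInd k γ b - Δ.gammaInd k γ a ∧ Δ.dot c h = x)
    (by
      rintro a b e _ _ ⟨h, hpos, hb, rfl⟩ ⟨h', hpos', hb', rfl⟩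
      exact ⟨h + h', fun f => add_nonneg (hpos f) (hpos' f), by rw [map_add, hb, hb']; abel,
        Δ.dot_add_right c h h'⟩)
    (by
      rintro a _ ⟨h, hpos, hb, rfl⟩
      exact hc h hpos (by rw [hb, sub_self]))
    Finset.univ
    (fun a b x => ∃ g, Δ.edgeFromTo k γ g a b ∧ c g = x)
    (by
      rintro a b _ ⟨g, hg, rfl⟩
      exact ⟨Pi.single g 1, fun f => (Pi.single_nonneg.2 zero_le_one : (0 : Δ.Chain k) ≤ _) f,
        hg, dotProduct_single_one c g⟩)
    (by
      obtain ⟨m, hm⟩ := (Set.finite_range c).bddBelow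
      refine ⟨m, ?_⟩
      rintro a b _ ⟨g, -, rfl⟩
      exact hm ⟨g, rfl⟩)
  let y : Δ.Chain (k + 1) := fun f => γ f * (p (some f) - p none)
  have hy : ∀ v, Δ.dot (Δ.gammaInd k γ v) y = p v - p none := by
    rintro (_ | f)
    · simp [dot, gammaInd]
    · have : γ f * γ f = 1 := by rcases hγ.1 f with h | h <;> simp [h]
      change Pi.single f (γ f) ⬝ᵥ y = _
      rw [single_dotProduct, ← mul_assoc, this, one_mul]
  refine ⟨y, fun g => ?_⟩
  obtain ⟨a, b, hab⟩ := Δ.exists_edgeFromTo_s13 hγ g (hbranch g g.2)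
  have hle := hp a (Finset.mem_univ _) b (Finset.mem_univ _) _ ⟨g, hab, rfl⟩
  have hval : Δ.bdry k y g = p b - p a := by
    calc Δ.bdry k y g = Δ.dot (Δ.bdry k y) (Pi.single g 1) :=
          (dotProduct_single_one (Δ.bdry k y) g).symm
      _ = Δ.dot (Δ.tbdry k (Pi.single g 1)) y := by rw [dot_bdry]; exact dotProduct_comm _ _
      _ = Δ.dot (Δ.gammaInd k γ b) y - Δ.dot (Δ.gammaInd k γ a) y := by
          rw [show Δ.tbdry k (Pi.single g 1) = _ from hab]; exact sub_dotProduct _ _ _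
      _ = p b - p a := by rw [hy, hy]; ring
  linarith

theorem Winnable.mono {i : ℕ} {σ σ' : Δ.Chain (i + 1)} (hσ : Δ.Winnable i σ) (hle : σ ≤ σ') :
    Δ.Winnable i σ' := by
  obtain ⟨τ, hτ, hlin⟩ := hσ
  refine ⟨τ + (σ' - σ), fun f => add_nonneg (hτ f) (sub_nonneg.2 (hle f)), ?_⟩
  rwa [LinEquiv, show τ + (σ' - σ) - σ' = τ - σ by abel]

end SComplex

/-- Let `Δ` be an orientable pseudomanifold of dimension `d+1`.
If `ω` is a chain of dimension `(d+1)-1` such that every chain of the same degree as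
`ω` is winnable, then every chain of degree at least that of `ω` is winnable. -/
theorem pseudomanifold_winnable_above_degree {n : ℕ} (Δ : SComplex n) (d : ℕ)
    (hpm : Δ.IsPseudomanifold (d + 1))
    (hor : ∃ γ : Δ.Chain (d + 2), Δ.IsOrientation (d + 1) γ)
    (ω : Δ.Chain (d + 1))
    (hω : ∀ σ : Δ.Chain (d + 1),
      (∀ h ∈ Δ.kerPlus d, Δ.dot σ h = Δ.dot ω h) → Δ.Winnable d σ) :
    ∀ σ : Δ.Chain (d + 1),
      (∀ h ∈ Δ.kerPlus d, Δ.dot ω h ≤ Δ.dot σ h) → Δ.Winnable d σ := by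
  obtain ⟨γ, hγ⟩ := hor
  intro σ hσ
  obtain ⟨y, hy⟩ := Δ.exists_bdry_le hγ hpm.2.1 (σ - ω) (by
    intro h hpos hker
    have hle := hσ h ⟨(Δ.Lap_eq_zero_iff d h).2 hker, hpos⟩
    have hadd := Δ.dot_add_left (σ - ω) ω h
    rw [sub_add_cancel] at hadd
    linarith)
  refine SComplex.Winnable.mono Δ (hω (ω + Δ.bdry (d + 1) y) fun h hh => ?_) fun g => ?_
  · have hzero : Δ.dot y 0 = 0 := dotProduct_zero y
    rw [SComplex.dot_add_left, SComplex.dot_bdry, (Δ.Lap_eq_zero_iff d h).1 hh.1, hzero, add_zero]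
  · have hle : Δ.bdry (d + 1) y g ≤ σ g - ω g := hy g
    change ω g + Δ.bdry (d + 1) y g ≤ σ g
    linarith
end

section
/- The i-forest number τ_i(Δ) equals 1 if and only if Skel_i(Δ) is a spanning i-forest of Δ and H̃_{i−1}(Δ) is torsion-free. Moreover, if Skel_i(Δ) is a spanning i-forest of Δ (regardless of whether H̃_{i−1}(Δ) is torsion-free), then Skel_i(Δ) is the unique spanning i-forest of Δ. -/
open Finset Matrix

theorem Submodule.finrank_eq_of_le_of_forall_exists_smul_mem {R M : Type*} [CommRing R]
    [IsDomain R] [AddCommGroup M] [Module R M] [Module.Finite R M] [IsNoetherianRing R]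
    {P Q : Submodule R M} (hle : P ≤ Q) (h : ∀ x ∈ Q, ∃ a : R, a ≠ 0 ∧ a • x ∈ P) :
    Module.finrank R P = Module.finrank R Q := by
  have htor : Module.finrank R (↥Q ⧸ P.comap Q.subtype) = 0 := by
    rw [Module.finrank_eq_zero_iff]
    intro x
    obtain ⟨y, rfl⟩ := Submodule.Quotient.mk_surjective _ x
    obtain ⟨a, ha, hay⟩ := h y y.2
    exact ⟨a, ha, (Submodule.Quotient.mk_eq_zero _).2 hay⟩
  have hadd := Submodule.finrank_quotient_add_finrank (P.comap Q.subtype)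
  rw [htor, zero_add, (Submodule.comapSubtypeEquivOfLe hle).finrank_eq] at hadd
  exact hadd

theorem Submodule.exists_smul_mem_of_finrank_eq {R M : Type*} [CommRing R]
    [IsDomain R] [AddCommGroup M] [Module R M] [Module.Finite R M] [IsNoetherianRing R]
    {P Q : Submodule R M} (hle : P ≤ Q) (h : Module.finrank R P = Module.finrank R Q)
    {x : M} (hx : x ∈ Q) : ∃ a : R, a ≠ 0 ∧ a • x ∈ P := by
  have hadd := Submodule.finrank_quotient_add_finrank (P.comap Q.subtype)
  rw [(Submodule.comapSubtypeEquivOfLe hle).finrank_eq, h, Nat.add_eq_right,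
    Module.finrank_eq_zero_iff] at hadd
  obtain ⟨a, ha, hax⟩ := hadd (Submodule.Quotient.mk ⟨x, hx⟩)
  exact ⟨a, ha, (Submodule.Quotient.mk_eq_zero (P.comap Q.subtype)).1 hax⟩

namespace SComplex

variable {n : ℕ} (Δ : SComplex n)

theorem suppIn_faces (k : ℕ) : Δ.suppIn k (Δ.Faces k) = ⊤ :=
  eq_top_iff.2 fun _ _ f hf => absurd f.2 hf

theorem suppIn_mono (k : ℕ) {F G : Finset (Finset (Fin n))} (h : F ⊆ G) :
    Δ.suppIn k F ≤ Δ.suppIn k G :=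
  fun _ hσ f hf => hσ f fun hF => hf (h hF)

/-- Chains supported on a set `F` of faces are families of coefficients indexed by `F`. -/
def suppInEquiv (k : ℕ) {F : Finset (Finset (Fin n))} (hF : F ⊆ Δ.Faces k) :
    Δ.suppIn k F ≃ₗ[ℤ] ({f // f ∈ F} → ℤ) where
  toFun σ := fun f => σ.1 ⟨f.1, hF f.2⟩
  map_add' _ _ := rfl
  map_smul' _ _ := rfl
  invFun c := ⟨fun f => if h : f.1 ∈ F then c ⟨f.1, h⟩ else 0, fun _ hf => dif_neg hf⟩
  left_inv σ := by
    ext f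
    by_cases h : f.1 ∈ F
    · simp [h]
    · simp [h, σ.2 f h]
  right_inv c := by
    ext f
    simp

theorem finrank_suppIn (k : ℕ) {F : Finset (Finset (Fin n))} (hF : F ⊆ Δ.Faces k) :
    Module.finrank ℤ (Δ.suppIn k F) = F.card := by
  rw [(Δ.suppInEquiv k hF).finrank_eq, Module.finrank_fintype_fun_eq_card, Fintype.card_coe]

theorem finrank_range_bdry_add_finrank_cycles (i : ℕ) :
    Module.finrank ℤ (LinearMap.range (Δ.bdry i)) + Module.finrank ℤ (Δ.cycles (i + 1)) =
      (Δ.Faces (i + 1)).card := by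
  have h := Submodule.finrank_quotient_add_finrank (LinearMap.ker (Δ.bdry i))
  rwa [(Δ.bdry i).quotKerEquivRange.finrank_eq, Module.finrank_fintype_fun_eq_card,
    Fintype.card_coe] at h

theorem finrank_map_bdry_suppIn {i : ℕ} {F : Finset (Finset (Fin n))} (hF : F ⊆ Δ.Faces (i + 1))
    (hind : ∀ σ ∈ Δ.suppIn (i + 1) F, Δ.bdry i σ = 0 → σ = 0) :
    Module.finrank ℤ ((Δ.suppIn (i + 1) F).map (Δ.bdry i)) = F.card := by
  have hinj : Function.Injective ((Δ.bdry i).domRestrict (Δ.suppIn (i + 1) F)) := by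
    rw [← LinearMap.ker_eq_bot, LinearMap.ker_eq_bot']
    exact fun σ hσ => Subtype.ext (hind σ σ.2 hσ)
  rw [← LinearMap.range_domRestrict, LinearMap.finrank_range_of_inj hinj, Δ.finrank_suppIn _ hF]

theorem isSpanningForest_of_independent {i : ℕ} {F : Finset (Finset (Fin n))}
    (hF : F ⊆ Δ.Faces (i + 1)) (hind : ∀ σ ∈ Δ.suppIn (i + 1) F, Δ.bdry i σ = 0 → σ = 0)
    (hcard : F.card = Module.finrank ℤ (LinearMap.range (Δ.bdry i))) :
    Δ.IsSpanningForest i F := by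
  have hle : (Δ.suppIn (i + 1) F).map (Δ.bdry i) ≤ LinearMap.range (Δ.bdry i) :=
    LinearMap.map_le_range
  refine ⟨hF, hind, ?_, ?_⟩
  · have h1 : Module.finrank ℤ (Δ.forestHom i F) + _ = _ :=
      Submodule.finrank_quotient_add_finrank
        (((Δ.suppIn (i + 1) F).map (Δ.bdry i)).comap (Δ.cycles i).subtype)
    have h2 : Module.finrank ℤ (Δ.RedHomologyAt i) + _ = _ :=
      Submodule.finrank_quotient_add_finrank (Δ.bdrySub i)
    have h3 : Module.finrank ℤ
        (((Δ.suppIn (i + 1) F).map (Δ.bdry i)).comap (Δ.cycles i).subtype) =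
        Module.finrank ℤ (Δ.bdrySub i) := by
      refine Submodule.finrank_eq_of_le_of_forall_exists_smul_mem (Submodule.comap_mono hle) ?_
      intro x hx
      exact Submodule.exists_smul_mem_of_finrank_eq hle
        ((Δ.finrank_map_bdry_suppIn hF hind).trans hcard) hx
    omega
  · have := Δ.finrank_range_bdry_add_finrank_cycles i
    omega

theorem bdry_single_ne_zero {i : ℕ} (f : {f // f ∈ Δ.Faces (i + 1)}) :
    Δ.bdry i (Pi.single f 1) ≠ 0 := by
  obtain ⟨f, hf⟩ := f
  obtain ⟨hfΔ, hfc⟩ := Finset.mem_filter.1 hf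
  obtain ⟨v, hv⟩ : f.Nonempty := Finset.card_pos.1 (by omega)
  have hec : (f.erase v).card = i := by rw [Finset.card_erase_of_mem hv, hfc]; rfl
  have he : f.erase v ∈ Δ.Faces i :=
    Finset.mem_filter.2 ⟨Δ.down_closed f hfΔ _ (Finset.erase_subset v f), hec⟩
  intro h
  have h0 := congrFun h ⟨f.erase v, he⟩
  have hd : f \ f.erase v = {v} := Finset.sdiff_erase_self hv
  simp [bdry, B, bcoef, Finset.erase_subset, hec, hfc, hd] at h0

/-- If there is a spanning `i`-forest, then every `i`-face lies in one. -/
theorem IsSpanningForest.exists_mem {i : ℕ} {F : Finset (Finset (Fin n))}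
    (hF : Δ.IsSpanningForest i F) {f : Finset (Fin n)} (hf : f ∈ Δ.Faces (i + 1)) :
    ∃ F', Δ.IsSpanningForest i F' ∧ f ∈ F' := by
  by_cases hfF : f ∈ F
  · exact ⟨F, hF, hfF⟩
  obtain ⟨hsub, hind, -, hcard⟩ := hF
  have hrank := Δ.finrank_range_bdry_add_finrank_cycles i
  have hG : insert f F ⊆ Δ.Faces (i + 1) := Finset.insert_subset hf hsub
  have hGc : (insert f F).card = F.card + 1 := Finset.card_insert_of_notMem hfF
  obtain ⟨σ, hσG, hσ0, hσne⟩ :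
      ∃ σ ∈ Δ.suppIn (i + 1) (insert f F), Δ.bdry i σ = 0 ∧ σ ≠ 0 := by
    by_contra! hcon
    have h1 := Δ.finrank_map_bdry_suppIn hG hcon
    have h2 := Submodule.finrank_mono (R := ℤ)
      (LinearMap.map_le_range (f := Δ.bdry i) (p := Δ.suppIn (i + 1) (insert f F)))
    omega
  have hσf : σ ⟨f, hf⟩ ≠ 0 := by
    intro h0
    refine hσne (hind σ (fun g hg => ?_) hσ0)
    by_cases hgf : g = ⟨f, hf⟩
    · rw [hgf, h0]
    · exact hσG g (by simpa [hg, Subtype.ext_iff] using hgf)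
  obtain ⟨g, hgf, hσg⟩ : ∃ g, g ≠ ⟨f, hf⟩ ∧ σ g ≠ 0 := by
    by_contra! hcon
    have hs : σ = σ ⟨f, hf⟩ • Pi.single (⟨f, hf⟩ : {f // f ∈ Δ.Faces (i + 1)}) (1 : ℤ) := by
      ext g
      by_cases hg : g = ⟨f, hf⟩
      · simp [hg]
      · simp [hg, hcon g hg]
    rw [hs, map_smul, smul_eq_zero] at hσ0
    exact hσ0.elim hσf (Δ.bdry_single_ne_zero _)
  have hgF : g.1 ∈ F := by
    by_contra hgF
    exact hσg (hσG g (by simpa [hgF, Subtype.ext_iff] using hgf))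
  have hgG : g.1 ∈ insert f F := Finset.mem_insert_of_mem hgF
  have hfg : f ≠ g.1 := fun h => hfF (h ▸ hgF)
  refine ⟨(insert f F).erase g.1, Δ.isSpanningForest_of_independent
    ((Finset.erase_subset _ _).trans hG) (fun τ hτ hτ0 => ?_) ?_,
    Finset.mem_erase.2 ⟨hfg, Finset.mem_insert_self f F⟩⟩
  · have hτg : τ g = 0 := hτ g (Finset.notMem_erase _ _)
    have hτG := Δ.suppIn_mono (i + 1) (Finset.erase_subset g.1 (insert f F)) hτ
    have hcomb : σ ⟨f, hf⟩ • τ - τ ⟨f, hf⟩ • σ = 0 := by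
      refine hind _ (fun x hx => ?_)
        (by rw [map_sub, map_smul, map_smul, hτ0, hσ0, smul_zero, smul_zero, sub_zero])
      by_cases hxf : x = ⟨f, hf⟩
      · simp [hxf, mul_comm]
      · have hxG : x.1 ∉ insert f F := by simpa [hx, Subtype.ext_iff] using hxf
        simp [hσG x hxG, hτG x hxG]
    have hτf : τ ⟨f, hf⟩ = 0 := by
      have := congrFun hcomb g
      simpa [hτg, hσg] using this
    rw [hτf, zero_smul, sub_zero] at hcomb
    exact (smul_eq_zero.1 hcomb).resolve_left hσf
  · rw [Finset.card_erase_of_mem hgG, hGc]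
    omega

theorem IsSpanningForest.eq_faces {i : ℕ} (h : Δ.IsSpanningForest i (Δ.Faces (i + 1)))
    {F : Finset (Finset (Fin n))} (hF : Δ.IsSpanningForest i F) : F = Δ.Faces (i + 1) :=
  Finset.eq_of_subset_of_card_le hF.1 (h.2.2.2.trans hF.2.2.2.symm).le

instance finite_torsion_forestHom (i : ℕ) (F : Finset (Finset (Fin n))) :
    Finite (Submodule.torsion ℤ (Δ.forestHom i F)) :=
  Module.finite_of_fg_torsion _ Submodule.torsion_isTorsion

theorem torsion_forestHom_faces_eq_bot_iff (i : ℕ) :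
    Submodule.torsion ℤ (Δ.forestHom i (Δ.Faces (i + 1))) = ⊥ ↔
      Submodule.torsion ℤ (Δ.RedHomologyAt i) = ⊥ := by
  unfold forestHom RedHomologyAt bdrySub
  rw [suppIn_faces, Submodule.map_top]

theorem forestNumber_of_isSpanningForest_faces {i : ℕ}
    (h : Δ.IsSpanningForest i (Δ.Faces (i + 1))) :
    Δ.forestNumber i =
      Nat.card (Submodule.torsion ℤ (Δ.forestHom i (Δ.Faces (i + 1)))) ^ 2 := by
  classical
  unfold forestNumber
  refine Finset.sum_eq_single_of_mem _ (by simp [h]) fun F hF hne => ?_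
  exact absurd (h.eq_faces Δ (Finset.mem_filter.1 hF).2) hne

theorem isSpanningForest_faces_of_forestNumber_eq_one {i : ℕ} (h : Δ.forestNumber i = 1) :
    Δ.IsSpanningForest i (Δ.Faces (i + 1)) := by
  classical
  have hle : ((Δ.Faces (i + 1)).powerset.filter fun F => Δ.IsSpanningForest i F).card ≤ 1 := by
    refine le_of_le_of_eq ?_ h
    rw [Finset.card_eq_sum_ones]
    unfold forestNumber
    convert Finset.sum_le_sum fun F _ => Nat.one_le_pow 2
      (Nat.card (Submodule.torsion ℤ (Δ.forestHom i F))) Nat.card_pos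
  obtain ⟨F, hF⟩ : ∃ F, Δ.IsSpanningForest i F := by
    by_contra! hcon
    simp [forestNumber, hcon] at h
  have hmem : ∀ {G}, Δ.IsSpanningForest i G →
      G ∈ (Δ.Faces (i + 1)).powerset.filter fun F => Δ.IsSpanningForest i F :=
    fun hG => Finset.mem_filter.2 ⟨Finset.mem_powerset.2 hG.1, hG⟩
  have hFaces : F = Δ.Faces (i + 1) := hF.1.antisymm fun f hf => by
    obtain ⟨F', hF', hfF'⟩ := hF.exists_mem Δ hf
    rwa [Finset.card_le_one.1 hle F (hmem hF) F' (hmem hF')]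
  exact hFaces ▸ hF

end SComplex

/-- `τ_i(Δ) = 1` if and only if `Skel_i(Δ)` (i.e. the full set of
`i`-faces) is a spanning `i`-forest of `Δ` and `H̃_{i-1}(Δ)` is torsion-free.
Moreover, if `Skel_i(Δ)` is a spanning `i`-forest of `Δ`, then it is the unique
spanning `i`-forest of `Δ`. -/
theorem forest_number_eq_one_iff {n : ℕ} (Δ : SComplex n) (i : ℕ) :
    (Δ.forestNumber i = 1 ↔
      (Δ.IsSpanningForest i (Δ.Faces (i + 1)) ∧
        Submodule.torsion ℤ (Δ.RedHomologyAt i) = ⊥)) ∧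
    (Δ.IsSpanningForest i (Δ.Faces (i + 1)) →
      ∀ F : Finset (Finset (Fin n)), Δ.IsSpanningForest i F → F = Δ.Faces (i + 1)) := by
  have key (h : Δ.IsSpanningForest i (Δ.Faces (i + 1))) :
      Δ.forestNumber i = 1 ↔ Submodule.torsion ℤ (Δ.RedHomologyAt i) = ⊥ := by
    rw [Δ.forestNumber_of_isSpanningForest_faces h, ← Δ.torsion_forestHom_faces_eq_bot_iff,
      ← Submodule.subsingleton_iff_eq_bot, Nat.pow_eq_one, or_iff_left two_ne_zero,
      Nat.card_eq_one_iff_unique]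
    exact and_iff_left inferInstance
  refine ⟨⟨fun h => ?_, fun h => (key h.1).2 h.2⟩, fun h _ hF => h.eq_faces Δ hF⟩
  have hfull := Δ.isSpanningForest_faces_of_forestNumber_eq_one h
  exact ⟨hfull, (key hfull).1 h⟩
end
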